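/- arXiv:2102.02634 — 3 statements merged into one kernel-verified Lean document; each statement's English description precedes it below -/
import Mathlib

section
/- The integral over the whole real line of the square of the zeroth spherical Bessel function equals π: ∫_{−∞}^{∞} (sin(x)/x)² dx = π, the case k = l = 0 of the orthogonality relation ∫_{−∞}^{∞} j_k(x) j_l(x) dx = π/(2l+1)·δ_{kl}. -/
open Real MeasureTheory

open scoped FourierTransform

lemma integrable_sin_div_self_sq : Integrable fun x : ℝ ↦ (sin x / x) ^ 2 := by
  refine (integrable_inv_one_add_sq.const_mul 2).mono'
    ((measurable_sin.div measurable_id).pow_const 2).aestronglyMeasurable (.of_forall fun x ↦ ?_)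
  rw [norm_of_nonneg (by positivity)]
  rcases eq_or_ne x 0 with rfl | hx
  · simp
  have hx2 : 0 < x ^ 2 := by positivity
  rw [← div_eq_mul_inv, div_pow, div_le_div_iff₀ hx2 (by positivity)]
  have h1 : sin x ^ 2 ≤ x ^ 2 := sq_le_sq.mpr abs_sin_le_abs
  nlinarith [mul_le_mul_of_nonneg_right (sin_sq_le_one x) hx2.le]

/-- The triangle function, supported on `[-1, 1]`, with peak value `1` at `0`. -/
noncomputable def triangle (t : ℝ) : ℂ := ((max 0 (1 - |t|) : ℝ) : ℂ)

lemma continuous_triangle : Continuous triangle := by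
  unfold triangle
  fun_prop

lemma triangle_eq_zero {t : ℝ} (ht : t ∉ Set.Ioc (-1) 1) : triangle t = 0 := by
  have h : 1 ≤ |t| := by
    by_contra! h
    exact ht ⟨(abs_lt.mp h).1, (abs_lt.mp h).2.le⟩
  simp [triangle, h]

lemma integrable_triangle : Integrable triangle := by
  refine continuous_triangle.integrable_of_hasCompactSupport
    (.intro (isCompact_Icc (a := (-1 : ℝ)) (b := 1)) fun t ht ↦ triangle_eq_zero fun h ↦ ht ?_)
  exact Set.Ioc_subset_Icc_self h

lemma integral_exp_mul_triangle {c : ℂ} (hc : c ≠ 0) :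
    ∫ t : ℝ, Complex.exp (c * t) * triangle t
      = (Complex.exp c + Complex.exp (-c) - 2) / c ^ 2 := by
  have hcont : Continuous fun t : ℝ ↦ Complex.exp (c * t) * triangle t :=
    Continuous.mul (by fun_prop) continuous_triangle
  have hexp (t : ℝ) :
      HasDerivAt (fun t : ℝ ↦ Complex.exp (c * t)) (Complex.exp (c * t) * c) t := by
    simpa using ((Complex.ofRealCLM.hasDerivAt (x := t)).const_mul c).cexp
  have hid (t : ℝ) : HasDerivAt (fun t : ℝ ↦ (t : ℂ)) 1 t := Complex.ofRealCLM.hasDerivAt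
  have hright : ∫ t in (0 : ℝ)..1, Complex.exp (c * t) * triangle t
      = Complex.exp c / c ^ 2 - (1 / c + 1 / c ^ 2) := by
    rw [intervalIntegral.integral_eq_sub_of_hasDerivAt
      (f := fun t : ℝ ↦ Complex.exp (c * t) * ((1 - t) / c + 1 / c ^ 2)) _
      (hcont.intervalIntegrable _ _)]
    · simp
      ring
    · intro t ht
      rw [Set.uIcc_of_le zero_le_one] at ht
      have htri : triangle t = 1 - t := by
        rw [triangle, abs_of_nonneg ht.1, max_eq_right (by linarith [ht.2])]
        push_cast
        rfl
      refine ((hexp t).mul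
        ((((hid t).const_sub 1).div_const c).add_const (1 / c ^ 2))).congr_deriv ?_
      rw [htri]
      field_simp
      ring
  have hleft : ∫ t in (-1 : ℝ)..0, Complex.exp (c * t) * triangle t
      = (1 / c - 1 / c ^ 2) + Complex.exp (-c) / c ^ 2 := by
    rw [intervalIntegral.integral_eq_sub_of_hasDerivAt
      (f := fun t : ℝ ↦ Complex.exp (c * t) * ((1 + t) / c - 1 / c ^ 2)) _
      (hcont.intervalIntegrable _ _)]
    · simp
      ring
    · intro t ht
      rw [Set.uIcc_of_le (by norm_num)] at ht
      have htri : triangle t = 1 + t := by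
        rw [triangle, abs_of_nonpos ht.2, max_eq_right (by linarith [ht.1])]
        push_cast
        ring
      refine ((hexp t).mul
        ((((hid t).const_add 1).div_const c).sub_const (1 / c ^ 2))).congr_deriv ?_
      rw [htri]
      field_simp
      ring
  rw [← setIntegral_eq_integral_of_forall_compl_eq_zero (s := Set.Ioc (-1) 1)
      fun t ht ↦ by rw [triangle_eq_zero ht, mul_zero],
    ← intervalIntegral.integral_of_le (by norm_num),
    ← intervalIntegral.integral_add_adjacent_intervals (b := 0)
      (hcont.intervalIntegrable _ _) (hcont.intervalIntegrable _ _), hleft, hright]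
  ring

lemma fourier_triangle {w : ℝ} (hw : w ≠ 0) :
    𝓕 triangle w = (((sin (π * w) / (π * w)) ^ 2 : ℝ) : ℂ) := by
  have hwC : (w : ℂ) ≠ 0 := mod_cast hw
  have hpi : (π : ℂ) ≠ 0 := mod_cast pi_ne_zero
  set z : ℂ := π * w with hz
  have hz0 : z ≠ 0 := mul_ne_zero hpi hwC
  have hc : -(2 * z * Complex.I) ≠ 0 := by simp [hz0]
  have hint : 𝓕 triangle w = ∫ t : ℝ, Complex.exp (-(2 * z * Complex.I) * t) * triangle t := by
    rw [fourier_real_eq_integral_exp_smul]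
    congr 1 with t
    rw [smul_eq_mul, hz]
    push_cast
    ring_nf
  have hcos : Complex.exp (-(2 * z * Complex.I)) + Complex.exp (2 * z * Complex.I)
      = 2 - 4 * Complex.sin z ^ 2 := by
    have h := Complex.two_cos (2 * z)
    rw [Complex.cos_two_mul, Complex.cos_sq', neg_mul] at h
    linear_combination -h
  rw [hint, integral_exp_mul_triangle hc, neg_neg, hcos]
  push_cast
  rw [← hz, neg_sq, mul_pow, Complex.I_sq]
  field_simp
  ring

theorem j0_norm_integral : ∫ x : ℝ, (sin x / x) ^ 2 = π := by
  have hae : 𝓕 triangle =ᵐ[volume] fun w : ℝ ↦ (((sin (π * w) / (π * w)) ^ 2 : ℝ) : ℂ) := by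
    filter_upwards [Measure.ae_ne volume (0 : ℝ)] with w hw using fourier_triangle hw
  have hint : Integrable (𝓕 triangle) :=
    ((integrable_sin_div_self_sq.comp_mul_left' pi_ne_zero).ofReal).congr hae.symm
  have hinv := integrable_triangle.fourierInv_fourier_eq hint (v := 0)
    continuous_triangle.continuousAt
  have hone : ∫ w : ℝ, (sin (π * w) / (π * w)) ^ 2 = 1 := by
    rw [fourierInv_eq'] at hinv
    simp only [inner_zero_right, mul_zero, Complex.ofReal_zero, zero_mul, Complex.exp_zero,
      one_smul] at hinv
    rw [integral_congr_ae hae, integral_complex_ofReal] at hinv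
    simpa [triangle] using hinv
  rw [Measure.integral_comp_mul_left (fun x ↦ (sin x / x) ^ 2), abs_of_pos (by positivity),
    smul_eq_mul, inv_mul_eq_one₀ pi_ne_zero] at hone
  exact hone.symm
end

section
/- For all real m > 0 and all real α, β, μ with α ≠ 0, β ≠ 0, μ ≠ 0, the definite integral of x² times an exponential times three zeroth-order spherical Bessel functions evaluates to: ∫_0^∞ x² e^{−mx} j₀(αx) j₀(βx) j₀(μx) dx = (1/(4αβμ))·[ arctan((α+β−μ)/m) + arctan((β+μ−α)/m) + arctan((μ+α−β)/m) − arctan((α+β+μ)/m) ], where j₀(t) = sin(t)/t. -/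
open Real MeasureTheory

theorem integrableOn_exp_mul_sin_mul_div {m : ℝ} (hm : 0 < m) (p : ℝ) :
    IntegrableOn (fun x : ℝ ↦ exp (-m * x) * (sin (p * x) / x)) (Set.Ioi 0) := by
  refine ((integrableOn_exp_mul_Ioi (neg_lt_zero.2 hm) 0).mul_const |p|).mono' ?_ ?_
  · exact Measurable.aestronglyMeasurable (by fun_prop)
  · filter_upwards [ae_restrict_mem measurableSet_Ioi] with x (hx : 0 < x)
    rw [norm_mul, norm_eq_abs, norm_eq_abs, abs_exp, abs_div]
    gcongr
    rw [div_le_iff₀ (abs_pos.2 hx.ne'), ← abs_mul]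
    exact abs_sin_le_abs

theorem integral_exp_mul_cos_mul_Ioi {m : ℝ} (hm : 0 < m) (p : ℝ) :
    ∫ x in Set.Ioi (0 : ℝ), exp (-m * x) * cos (p * x) = m / (m ^ 2 + p ^ 2) := by
  have ha : (⟨-m, p⟩ : ℂ).re < 0 := neg_lt_zero.2 hm
  have hre : ∀ x : ℝ, exp (-m * x) * cos (p * x) =
      RCLike.re (Complex.exp ((⟨-m, p⟩ : ℂ) * x)) := fun x ↦ by
    simp [Complex.exp_re]
  simp_rw [hre]
  rw [integral_re (integrableOn_exp_mul_complex_Ioi ha 0), integral_exp_mul_complex_Ioi ha 0]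
  simp [Complex.div_re, Complex.normSq_apply, pow_two]

theorem hasDerivAt_integral_exp_mul_sin_mul_div {m : ℝ} (hm : 0 < m) (p : ℝ) :
    HasDerivAt (fun q : ℝ ↦ ∫ x in Set.Ioi (0 : ℝ), exp (-m * x) * (sin (q * x) / x))
      (m / (m ^ 2 + p ^ 2)) p := by
  rw [← integral_exp_mul_cos_mul_Ioi hm]
  refine (hasDerivAt_integral_of_dominated_loc_of_deriv_le
    (μ := volume.restrict (Set.Ioi 0)) (F := fun q x ↦ exp (-m * x) * (sin (q * x) / x))
    (F' := fun q x ↦ exp (-m * x) * cos (q * x)) (bound := fun x ↦ exp (-m * x))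
    Filter.univ_mem ?_ (integrableOn_exp_mul_sin_mul_div hm p) ?_ ?_
    (integrableOn_exp_mul_Ioi (neg_lt_zero.2 hm) 0) ?_).2
  · exact .of_forall fun q ↦ (integrableOn_exp_mul_sin_mul_div hm q).aestronglyMeasurable
  · exact Measurable.aestronglyMeasurable (by fun_prop)
  · refine .of_forall fun x q _ ↦ ?_
    rw [norm_mul, norm_eq_abs, norm_eq_abs, abs_exp]
    exact mul_le_of_le_one_right (exp_pos _).le (abs_cos_le_one _)
  · filter_upwards [ae_restrict_mem measurableSet_Ioi] with x (hx : 0 < x) q _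
    have h := (((hasDerivAt_mul_const (x := q) x).sin).div_const x).const_mul (exp (-m * x))
    rwa [mul_div_cancel_right₀ _ hx.ne'] at h

theorem integral_exp_mul_sin_mul_div_Ioi {m : ℝ} (hm : 0 < m) (p : ℝ) :
    ∫ x in Set.Ioi (0 : ℝ), exp (-m * x) * (sin (p * x) / x) = arctan (p / m) := by
  have hderiv : ∀ q, HasDerivAt (fun q : ℝ ↦
      (∫ x in Set.Ioi (0 : ℝ), exp (-m * x) * (sin (q * x) / x)) - arctan (q / m)) 0 q := by
    intro q
    have h := (hasDerivAt_integral_exp_mul_sin_mul_div hm q).sub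
      ((hasDerivAt_id q).div_const m).arctan
    convert! h using 1
    have : 0 < m ^ 2 + q ^ 2 := by positivity
    simp only [id]
    field_simp
    ring
  have h := is_const_of_deriv_eq_zero (fun q ↦ (hderiv q).differentiableAt)
    (fun q ↦ (hderiv q).deriv) p 0
  simpa [sub_eq_zero] using h

theorem four_mul_sin_mul_sin_mul_sin (a b c : ℝ) :
    4 * (sin a * sin b * sin c) =
      sin (a + b - c) + sin (b + c - a) + sin (c + a - b) - sin (a + b + c) := by
  simp only [sin_add, sin_sub, cos_add]
  ring

theorem three_bessel_integral_n_two (m : ℝ) (hm : 0 < m) (α β μ : ℝ)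
    (hα : α ≠ 0) (hβ : β ≠ 0) (hμ : μ ≠ 0) :
    ∫ x in Set.Ioi (0 : ℝ),
        x ^ 2 * Real.exp (-m * x) * (sin (α * x) / (α * x)) * (sin (β * x) / (β * x))
          * (sin (μ * x) / (μ * x))
      = (1 / (4 * α * β * μ)) *
          (arctan ((α + β - μ) / m) + arctan ((β + μ - α) / m) + arctan ((μ + α - β) / m)
            - arctan ((α + β + μ) / m)) := by
  have hint := integrableOn_exp_mul_sin_mul_div hm
  simp_rw [← integral_exp_mul_sin_mul_div_Ioi hm]
  rw [← integral_add (hint _) (hint _), ← integral_add ((hint _).fun_add (hint _)) (hint _),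
    ← integral_sub (((hint _).fun_add (hint _)).fun_add (hint _)) (hint _),
    ← integral_const_mul]
  refine setIntegral_congr_fun measurableSet_Ioi fun x (hx : 0 < x) ↦ ?_
  have h := four_mul_sin_mul_sin_mul_sin (α * x) (β * x) (μ * x)
  simp only [mul_comm _ x, ← mul_add, ← mul_sub] at h
  have hx' := hx.ne'
  field_simp
  linear_combination h
end

section
/- For all real m > 0 and all real α, β, μ with α ≠ 0, β ≠ 0, μ ≠ 0, writing a₁ = α+β−μ, a₂ = β+μ−α, a₃ = μ+α−β and s = α+β+μ, the following evaluation holds: ∫_0^∞ x³ e^{−mx} j₀(αx) j₀(βx) j₀(μx) dx = (1/(4αβμ))·[ a₁/(m²+a₁²) + a₂/(m²+a₂²) + a₃/(m²+a₃²) − s/(m²+s²) ], where j₀(t) = sin(t)/t. -/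
open Real MeasureTheory

theorem exp_neg_mul_mul_sin_eq_im (m a x : ℝ) :
    Real.exp (-m * x) * sin (a * x) = (Complex.exp ((⟨-m, a⟩ : ℂ) * x)).im := by
  simp [Complex.exp_im]

theorem integrableOn_exp_neg_mul_mul_sin_Ioi {m : ℝ} (hm : 0 < m) (a : ℝ) :
    IntegrableOn (fun x : ℝ => Real.exp (-m * x) * sin (a * x)) (Set.Ioi 0) := by
  simp_rw [exp_neg_mul_mul_sin_eq_im]
  exact (integrableOn_exp_mul_complex_Ioi (a := ⟨-m, a⟩) (by simpa using hm) 0).im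

theorem integral_exp_neg_mul_mul_sin_Ioi {m : ℝ} (hm : 0 < m) (a : ℝ) :
    ∫ x in Set.Ioi (0 : ℝ), Real.exp (-m * x) * sin (a * x) = a / (m ^ 2 + a ^ 2) := by
  have hre : (⟨-m, a⟩ : ℂ).re < 0 := by simpa using hm
  simp_rw [exp_neg_mul_mul_sin_eq_im]
  have h := integral_im (integrableOn_exp_mul_complex_Ioi hre 0)
  simp only [RCLike.im_to_complex] at h
  rw [h, integral_exp_mul_complex_Ioi hre]
  simp [Complex.div_im, Complex.normSq_apply]
  ring

theorem sin_mul_sin_mul_sin (x y z : ℝ) :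
    sin x * sin y * sin z =
      (sin (x + y - z) + sin (y + z - x) + sin (z + x - y) - sin (x + y + z)) / 4 := by
  simp only [sin_add, sin_sub, cos_add]
  ring

theorem three_bessel_integral_n_three (m : ℝ) (hm : 0 < m) (α β μ : ℝ)
    (hα : α ≠ 0) (hβ : β ≠ 0) (hμ : μ ≠ 0) :
    ∫ x in Set.Ioi (0 : ℝ),
        x ^ 3 * Real.exp (-m * x) * (sin (α * x) / (α * x)) * (sin (β * x) / (β * x))
          * (sin (μ * x) / (μ * x))
      = (1 / (4 * α * β * μ)) *
          ((α + β - μ) / (m ^ 2 + (α + β - μ) ^ 2)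
            + (β + μ - α) / (m ^ 2 + (β + μ - α) ^ 2)
            + (μ + α - β) / (m ^ 2 + (μ + α - β) ^ 2)
            - (α + β + μ) / (m ^ 2 + (α + β + μ) ^ 2)) := by
  have key : ∀ x ∈ Set.Ioi (0 : ℝ),
      x ^ 3 * Real.exp (-m * x) * (sin (α * x) / (α * x)) * (sin (β * x) / (β * x))
          * (sin (μ * x) / (μ * x))
        = (1 / (4 * α * β * μ)) *
          (Real.exp (-m * x) * sin ((α + β - μ) * x)
            + Real.exp (-m * x) * sin ((β + μ - α) * x)
            + Real.exp (-m * x) * sin ((μ + α - β) * x)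
            - Real.exp (-m * x) * sin ((α + β + μ) * x)) := by
    intro x hx
    have hx0 : x ≠ 0 := ne_of_gt hx
    have h := sin_mul_sin_mul_sin (α * x) (β * x) (μ * x)
    simp only [← add_mul, ← sub_mul] at h
    calc
      _ = Real.exp (-m * x) / (α * β * μ) * (sin (α * x) * sin (β * x) * sin (μ * x)) := by
        field_simp
      _ = _ := by
        rw [h]
        ring
  have hi := integrableOn_exp_neg_mul_mul_sin_Ioi hm
  rw [setIntegral_congr_fun measurableSet_Ioi key, integral_const_mul,
    integral_sub (((hi _).fun_add (hi _)).fun_add (hi _)) (hi _),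
    integral_add ((hi _).fun_add (hi _)) (hi _), integral_add (hi _) (hi _)]
  simp only [integral_exp_neg_mul_mul_sin_Ioi hm]
end
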